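/- Let K be a field of characteristic 2. Then the element x₁² + x₁ of the free associative algebra K⟨x₁,…,xₙ⟩ has no square root: there is no f ∈ K⟨x₁,…,xₙ⟩ with f² = x₁² + x₁. -/

import Mathlib

/-- Over a nontrivial commutative ring of characteristic 2, `X² + X` is not a square, since its
derivative is `1` while the derivative of any square vanishes. -/
theorem Polynomial.sq_ne_X_sq_add_X {R : Type*} [CommRing R] [Nontrivial R] [CharP R 2]
    (g : Polynomial R) : g ^ 2 ≠ Polynomial.X ^ 2 + Polynomial.X := by
  intro h
  have hd := congrArg Polynomial.derivative h
  simp [Polynomial.derivative_pow, CharTwo.two_eq_zero] at hd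

/-- Let `K` be a field of characteristic 2. Then the element `x₁² + x₁`
of the free associative algebra `K⟨x₁,…,xₙ⟩` (on `n ≥ 1` generators) has no square root:
there is no `f ∈ K⟨x₁,…,xₙ⟩` with `f² = x₁² + x₁`. -/
theorem no_square_root_in_free_algebra_char_two
    {K : Type*} [Field K] (hchar : ringChar K = 2) {n : ℕ} (hn : 1 ≤ n) :
    ¬ ∃ f : FreeAlgebra K (Fin n),
        f ^ 2 = FreeAlgebra.ι K (⟨0, hn⟩ : Fin n) ^ 2 + FreeAlgebra.ι K (⟨0, hn⟩ : Fin n) := by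
  rintro ⟨f, hf⟩
  have : CharP K 2 := ringChar.of_eq hchar
  apply Polynomial.sq_ne_X_sq_add_X (FreeAlgebra.lift K (fun _ => (Polynomial.X : Polynomial K)) f)
  simpa using congrArg (FreeAlgebra.lift K (fun _ => (Polynomial.X : Polynomial K))) hf
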